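/- Suppose I = {1,2}. There exists a model M = (W, (N_i)_{i∈{1,2}}, V) and a world w of M such that every instance of the schemata □_1φ → φ and □_2φ → φ is true at every world of M, yet M,w ⊨ □_{{1,2}}⊥; hence the schema □_{{1,2}}φ → φ is not valid in M. (Concretely, one may take W = {w,v}, V making every atom true at both worlds, N_1 constantly {{w}} and N_2 constantly {{v}}.) -/

import Mathlib

attribute [local instance] Classical.propDecidable

/-- Formulas of the multi-modal language 𝔏: atoms, ⊥, ¬, ∨, and □_G for
finite nonempty G ⊆ I. -/
inductive Form (I : Type) : Type
  | atom : ℕ → Form I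
  | bot  : Form I
  | neg  : Form I → Form I
  | or   : Form I → Form I → Form I
  | box  : (G : Finset I) → G.Nonempty → Form I → Form I

namespace Form
variable {I : Type}
/-- φ ∧ ψ -/
def and (φ ψ : Form I) : Form I := .neg (.or (.neg φ) (.neg ψ))
/-- φ → ψ -/
def imp (φ ψ : Form I) : Form I := .or (.neg φ) ψ
/-- ⊤ -/
def top : Form I := .neg .bot
/-- φ ↔ ψ -/
def iff (φ ψ : Form I) : Form I := (φ.imp ψ).and (ψ.imp φ)
end Form

/-- The pointwise-intersection neighbourhood function:
`N_G(w) = { ⋂_{i∈G} X_i : X_i ∈ N_i(w) }`. -/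
def ptwInter {I W : Type} (N : I → W → Set (Set W)) (G : Finset I) (w : W) :
    Set (Set W) :=
  { X | ∃ Y : I → Set W, (∀ i ∈ G, Y i ∈ N i w) ∧ X = ⋂ i ∈ G, Y i }

/-- Satisfaction at a world, relative to neighbourhood functions `N` and a
valuation `V`. -/
def satN {I W : Type} (N : I → W → Set (Set W)) (V : ℕ → Set W) :
    Form I → W → Prop
  | .atom n, w => w ∈ V n
  | .bot, _ => False
  | .neg φ, w => ¬ satN N V φ w
  | .or φ ψ, w => satN N V φ w ∨ satN N V ψ w
  | .box G _ φ, w => { v | satN N V φ v } ∈ ptwInter N G w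

/-- A neighbourhood model. -/
structure NbhModel (I : Type) where
  W : Type
  ne : Nonempty W
  N : I → W → Set (Set W)
  V : ℕ → Set W

/-- Truth in a model. -/
def NbhModel.sat {I : Type} (M : NbhModel I) (w : M.W) (φ : Form I) : Prop :=
  satN M.N M.V φ w

/-- Propositional evaluation treating atoms and boxed formulas as atomic. -/
def evalP {I : Type} (v : Form I → Prop) : Form I → Prop
  | .atom n => v (.atom n)
  | .bot => False
  | .neg φ => ¬ evalP v φ
  | .or φ ψ => evalP v φ ∨ evalP v ψ
  | .box G h φ => v (.box G h φ)

/-- Classical propositional tautologies (in the extended modal language). -/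
def Tautology {I : Type} (φ : Form I) : Prop := ∀ v, evalP v φ

theorem unionNE {I : Type} [DecidableEq I] {G H : Finset I}
    (hG : G.Nonempty) : (G ∪ H).Nonempty :=
  hG.mono Finset.subset_union_left

/-- Axiom schema B1: `(□_Gφ ∧ □_Hψ) → □_{G∪H}(φ∧ψ)` for disjoint G, H. -/
def B1Ax (I : Type) [DecidableEq I] : Set (Form I) :=
  { χ | ∃ (G H : Finset I) (hG : G.Nonempty) (hH : H.Nonempty) (φ ψ : Form I),
      Disjoint G H ∧
      χ = ((Form.box G hG φ).and (Form.box H hH ψ)).imp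
            (Form.box (G ∪ H) (unionNE hG) (φ.and ψ)) }

/-- Axiom schema B2: `□_{G∪H}⊤ → □_G⊤`. -/
def B2Ax (I : Type) [DecidableEq I] : Set (Form I) :=
  { χ | ∃ (G H : Finset I) (hG : G.Nonempty) (_hH : H.Nonempty),
      χ = (Form.box (G ∪ H) (unionNE hG) Form.top).imp (Form.box G hG Form.top) }

/-- Axiom schema B3: `(□_Gφ ∧ □_{G∪H∪J}φ) → □_{G∪H}φ`. -/
def B3Ax (I : Type) [DecidableEq I] : Set (Form I) :=
  { χ | ∃ (G H J : Finset I) (hG : G.Nonempty) (_hH : H.Nonempty)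
      (_hJ : J.Nonempty) (φ : Form I),
      χ = ((Form.box G hG φ).and (Form.box (G ∪ H ∪ J) (unionNE (unionNE hG)) φ)).imp
            (Form.box (G ∪ H) (unionNE hG) φ) }

/-- Axiom schema B4: `(□_Gφ ∧ □_H(φ∨ψ)) → □_{G∪H}φ`. -/
def B4Ax (I : Type) [DecidableEq I] : Set (Form I) :=
  { χ | ∃ (G H : Finset I) (hG : G.Nonempty) (hH : H.Nonempty) (φ ψ : Form I),
      χ = ((Form.box G hG φ).and (Form.box H hH (φ.or ψ))).imp
            (Form.box (G ∪ H) (unionNE hG) φ) }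

/-- The axioms of the base logic. -/
def BaseAx (I : Type) [DecidableEq I] : Set (Form I) :=
  B1Ax I ∪ B2Ax I ∪ B3Ax I ∪ B4Ax I

/-- Hilbert-style provability from classical tautologies and the axioms in
`Ax`, closed under modus ponens and replacement of equivalents. -/
inductive Prv {I : Type} (Ax : Set (Form I)) : Form I → Prop
  | taut {φ : Form I} : Tautology φ → Prv Ax φ
  | ax {φ : Form I} : φ ∈ Ax → Prv Ax φ
  | mp {φ ψ : Form I} : Prv Ax (φ.imp ψ) → Prv Ax φ → Prv Ax ψ
  | re {φ ψ : Form I} (G : Finset I) (hG : G.Nonempty) :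
      Prv Ax (φ.iff ψ) → Prv Ax ((Form.box G hG φ).iff (Form.box G hG ψ))

/-- `Γ ⊢ φ` iff there are `ψ₁,…,ψₙ ∈ Γ` with `⊢ (ψ₁∧…∧ψₙ) → φ`. -/
def Deduces {I : Type} (Ax : Set (Form I)) (Γ : Set (Form I)) (φ : Form I) :
    Prop :=
  ∃ l : List (Form I), (∀ ψ ∈ l, ψ ∈ Γ) ∧
    Prv Ax ((l.foldr Form.and Form.top).imp φ)

/-- Semantic consequence over a class of models. -/
def SemConseq {I : Type} (C : NbhModel I → Prop) (Γ : Set (Form I))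
    (φ : Form I) : Prop :=
  ∀ M : NbhModel I, C M → ∀ w : M.W, (∀ ψ ∈ Γ, M.sat w ψ) → M.sat w φ

/-- Soundness and strong completeness of `Ax` w.r.t. the class `C`. -/
def SoundComplete {I : Type} (Ax : Set (Form I)) (C : NbhModel I → Prop) :
    Prop :=
  ∀ (Γ : Set (Form I)) (φ : Form I), Deduces Ax Γ φ ↔ SemConseq C Γ φ

theorem satN_iff_of_world_invariant {I W : Type} {N : I → W → Set (Set W)}
    {V : ℕ → Set W} (hN : ∀ i u v, N i u = N i v) (hV : ∀ n u v, u ∈ V n ↔ v ∈ V n)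
    (φ : Form I) (u v : W) : satN N V φ u ↔ satN N V φ v := by
  induction φ with
  | atom n => exact hV n u v
  | bot => exact Iff.rfl
  | neg φ ih => exact not_congr ih
  | or φ ψ ihφ ihψ => exact or_congr ihφ ihψ
  | box G hG φ _ => simp only [satN, ptwInter, Set.mem_ofPred_eq, hN _ u v]

/-- With I = {1,2} (here Fin 2), there is a model M and a world
w such that every instance of □_1φ → φ and □_2φ → φ is true at every world,
yet M,w ⊨ □_{{1,2}}⊥; hence □_{{1,2}}φ → φ is not valid in M. -/
theorem T_not_inherited :
    ∃ (M : NbhModel (Fin 2)) (w : M.W),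
      (∀ (i : Fin 2) (φ : Form (Fin 2)) (v : M.W),
        M.sat v ((Form.box {i} (Finset.singleton_nonempty i) φ).imp φ)) ∧
      M.sat w (Form.box (Finset.univ : Finset (Fin 2)) Finset.univ_nonempty
        Form.bot) ∧
      ∃ (φ : Form (Fin 2)) (v : M.W),
        ¬ M.sat v ((Form.box (Finset.univ : Finset (Fin 2))
          Finset.univ_nonempty φ).imp φ) := by
  let N : Fin 2 → Fin 2 → Set (Set (Fin 2)) := fun i _ => {{i}}
  let V : ℕ → Set (Fin 2) := fun _ => Set.univ
  have box_bot (w : Fin 2) :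
      satN N V (Form.box Finset.univ Finset.univ_nonempty Form.bot) w := by
    refine ⟨fun i => {i}, fun i _ => rfl, ?_⟩
    ext u
    simp only [satN, Set.mem_ofPred_eq, Set.mem_iInter, Set.mem_singleton_iff, false_iff]
    intro h
    exact absurd ((h 0 (Finset.mem_univ 0)).symm.trans (h 1 (Finset.mem_univ 1))) (by decide)
  refine ⟨⟨Fin 2, inferInstance, N, V⟩, (0 : Fin 2), ?_, box_bot 0, Form.bot, (0 : Fin 2), ?_⟩
  · intro i φ v
    left
    rintro ⟨Y, hY, hφ⟩
    have hYi : Y i = {i} := hY i (Finset.mem_singleton_self i)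
    have hsat (u : Fin 2) : satN N V φ u ↔ u = i := by
      have h := Set.ext_iff.mp hφ u
      simpa [hYi] using h
    have hall (u : Fin 2) : u = i :=
      (hsat u).mp ((satN_iff_of_world_invariant (fun _ _ _ => rfl) (fun _ _ _ => Iff.rfl)
        φ i u).mp ((hsat i).mpr rfl))
    exact absurd ((hall 0).trans (hall 1).symm) (by decide)
  · rintro (h | h)
    · exact h (box_bot 0)
    · exact h
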